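/- arXiv:quant-ph/0506039 — 2 statements merged into one kernel-verified Lean document; each statement's English description precedes it below -/
import Mathlib

section
/- Let I and J be finite nonempty index sets, let (p_i)_{i∈I} be a probability distribution, let (q_{ij})_{j∈J} be a probability distribution for each i ∈ I, and let σ_{ij} be density matrices on ℂ^m and η_{ij} be density matrices on ℂ^n for each (i,j). Then S(∑_{ij} p_i q_{ij} σ_{ij} ⊗ η_{ij}) − ∑_i p_i S(∑_j q_{ij} σ_{ij} ⊗ η_{ij}) − S(∑_{ij} p_i q_{ij} σ_{ij}) + ∑_i p_i S(∑_j q_{ij} σ_{ij}) ≤ S(∑_{ij} p_i q_{ij} σ_{ij} ⊗ η_{ij}) − ∑_{ij} p_i q_{ij} S(σ_{ij} ⊗ η_{ij}) − S(∑_{ij} p_i q_{ij} σ_{ij}) + ∑_{ij} p_i q_{ij} S(σ_{ij}). -/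
open scoped Kronecker BigOperators ComplexOrder

/-- Von Neumann entropy (base 2) of a matrix, via eigenvalues when Hermitian. -/
noncomputable def vNEntropy {n : Type*} [Fintype n] [DecidableEq n] (ρ : Matrix n n ℂ) : ℝ :=
  if h : ρ.IsHermitian then -∑ k, h.eigenvalues k * Real.logb 2 (h.eigenvalues k) else 0

/-- A density matrix: positive semidefinite with trace one. -/
def IsDensityMatrix {n : Type*} [Fintype n] [DecidableEq n] (ρ : Matrix n n ℂ) : Prop :=
  ρ.PosSemidef ∧ ρ.trace = 1

/-- Shannon entropy (base 2). -/
noncomputable def shannonH {I : Type*} [Fintype I] (p : I → ℝ) : ℝ :=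
  -∑ i, p i * Real.logb 2 (p i)

/-- Holevo information of an ensemble. -/
noncomputable def holevo {I n : Type*} [Fintype I] [Fintype n] [DecidableEq n]
    (p : I → ℝ) (ρ : I → Matrix n n ℂ) : ℝ :=
  vNEntropy (∑ i, (p i : ℂ) • ρ i) - ∑ i, p i * vNEntropy (ρ i)

open Matrix Filter Topology

/-! ### Scalar integrals behind the relative entropy -/

lemma tendsto_integral_resolvent_term {w r s : ℝ} (hs : 0 ≤ s) (h : w * s = 0 ∨ 0 < r) :
    (∀ T, 0 ≤ T → IntervalIntegrable (fun t => w * s ^ 2 / (r + t * s)) MeasureTheory.volume 0 T) ∧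
    Tendsto (fun T => (∫ t in (0 : ℝ)..T, w * s ^ 2 / (r + t * s)) - w * s * Real.log T) atTop
      (𝓝 (w * s * (Real.log s - Real.log r))) := by
  by_cases hws : w * s = 0
  · have h0 : ∀ t : ℝ, w * s ^ 2 / (r + t * s) = 0 := fun t => by
      rw [pow_two, ← mul_assoc, hws, zero_mul, zero_div]
    simp [h0, hws]
  · have hr : 0 < r := h.resolve_left hws
    have hs' : 0 < s := lt_of_le_of_ne hs fun h => hws (by simp [← h])
    have hpos : ∀ t : ℝ, 0 ≤ t → 0 < r + t * s := fun t ht => by positivity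
    have hint : ∀ T, 0 ≤ T →
        IntervalIntegrable (fun t => w * s ^ 2 / (r + t * s)) MeasureTheory.volume 0 T := by
      intro T hT
      apply ContinuousOn.intervalIntegrable
      rw [Set.uIcc_of_le hT]
      exact ContinuousOn.div (by fun_prop) (by fun_prop) fun t ht => (hpos t ht.1).ne'
    refine ⟨hint, ?_⟩
    have hval : ∀ T, 0 < T → (∫ t in (0 : ℝ)..T, w * s ^ 2 / (r + t * s)) - w * s * Real.log T
        = w * s * (Real.log (r / T + s) - Real.log r) := by
      intro T hT
      have hd : ∀ t ∈ Set.uIcc 0 T, HasDerivAt (fun t => w * s * Real.log (r + t * s))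
          (w * s ^ 2 / (r + t * s)) t := by
        intro t ht
        rw [Set.uIcc_of_le hT.le] at ht
        have h1 : HasDerivAt (fun t : ℝ => r + t * s) s t := by
          simpa using ((hasDerivAt_id t).mul_const s).const_add r
        exact ((h1.log (hpos t ht.1).ne').const_mul (w * s)).congr_deriv (by ring)
      rw [intervalIntegral.integral_eq_sub_of_hasDerivAt hd (hint T hT.le)]
      have h3 : r / T + s = (r + T * s) / T := by field_simp
      rw [h3, Real.log_div (hpos T hT.le).ne' hT.ne']
      simp only [zero_mul, add_zero]
      ring
    have hlim : Tendsto (fun T : ℝ => r / T + s) atTop (𝓝 s) := by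
      simpa using (tendsto_const_nhds.div_atTop tendsto_id).add_const s
    refine Tendsto.congr' ?_
      (((hlim.log hs'.ne').sub_const (Real.log r)).const_mul (w * s))
    filter_upwards [eventually_gt_atTop 0] with T hT using (hval T hT).symm

lemma tendsto_integral_resolvent_sum {k : Type*} [Fintype k] {w : k → k → ℝ} {r s : k → ℝ}
    (hs : ∀ b, 0 ≤ s b) (h : ∀ a b, w a b * s b = 0 ∨ 0 < r a)
    (h1 : ∑ a, ∑ b, w a b * s b = 1) :
    (∀ T, 0 ≤ T → IntervalIntegrable (fun t => ∑ a, ∑ b, w a b * s b ^ 2 / (r a + t * s b))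
      MeasureTheory.volume 0 T) ∧
    Tendsto (fun T => (∫ t in (0 : ℝ)..T, ∑ a, ∑ b, w a b * s b ^ 2 / (r a + t * s b))
        - Real.log T) atTop
      (𝓝 (∑ a, ∑ b, w a b * s b * (Real.log (s b) - Real.log (r a)))) := by
  have hterm := fun a b => tendsto_integral_resolvent_term (hs b) (h a b)
  have hinner : ∀ T, 0 ≤ T → ∀ a, IntervalIntegrable
      (fun t => ∑ b, w a b * s b ^ 2 / (r a + t * s b)) MeasureTheory.volume 0 T := by
    intro T hT a
    simpa only [Finset.sum_fn] using
      IntervalIntegrable.sum Finset.univ fun b _ => (hterm a b).1 T hT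
  refine ⟨fun T hT => ?_, ?_⟩
  · simpa only [Finset.sum_fn] using
      IntervalIntegrable.sum Finset.univ fun a _ => hinner T hT a
  · refine Tendsto.congr' ?_ (tendsto_finsetSum Finset.univ fun a _ =>
      tendsto_finsetSum Finset.univ fun b _ => (hterm a b).2)
    filter_upwards [eventually_ge_atTop 0] with T hT
    rw [intervalIntegral.integral_finsetSum fun a _ => hinner T hT a]
    simp_rw [Finset.sum_sub_distrib, ← Finset.sum_mul]
    rw [h1, one_mul]
    congr 1
    refine Finset.sum_congr rfl fun a _ => ?_
    rw [intervalIntegral.integral_finsetSum fun b _ => (hterm a b).1 T hT]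

/-! ### Relative entropy in terms of eigenvalues and overlaps -/

section RelativeEntropy

variable {k : Type*} [Fintype k] [DecidableEq k] {ρ R : Matrix k k ℂ}

/-- The unitary matrix of overlaps between eigenvectors of `R` and of `ρ`. -/
noncomputable def overlap (hρ : ρ.IsHermitian) (hR : R.IsHermitian) : Matrix k k ℂ :=
  (hR.eigenvectorUnitary : Matrix k k ℂ)ᴴ * (hρ.eigenvectorUnitary : Matrix k k ℂ)

/-- The quantum relative entropy (in nats) of `ρ` with respect to `R`. -/
noncomputable def relEntropy (hρ : ρ.IsHermitian) (hR : R.IsHermitian) : ℝ :=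
  ∑ a, ∑ b, Complex.normSq (overlap hρ hR a b) * hρ.eigenvalues b *
    (Real.log (hρ.eigenvalues b) - Real.log (hR.eigenvalues a))

/-- The expectation of the resolvent `(Δ + t)⁻¹` of the relative modular operator. -/
noncomputable def resolventForm (hρ : ρ.IsHermitian) (hR : R.IsHermitian) (t : ℝ) : ℝ :=
  ∑ a, ∑ b, Complex.normSq (overlap hρ hR a b) * hρ.eigenvalues b ^ 2 /
    (hR.eigenvalues a + t * hρ.eigenvalues b)

/-- The concave quadratic functional whose supremum over `X` is `resolventForm`. -/
noncomputable def modularQuadratic (ρ R : Matrix k k ℂ) (t : ℝ) (X : Matrix k k ℂ) : ℝ :=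
  2 * (ρ * X).trace.re - (Xᴴ * R * X).trace.re - t * (X * ρ * Xᴴ).trace.re

lemma Matrix.IsHermitian.eq_conj_diagonal (hρ : ρ.IsHermitian) :
    ρ = (hρ.eigenvectorUnitary : Matrix k k ℂ) * diagonal (fun b => (hρ.eigenvalues b : ℂ)) *
      (hρ.eigenvectorUnitary : Matrix k k ℂ)ᴴ := by
  have h := hρ.spectral_theorem
  rw [Unitary.conjStarAlgAut_apply] at h
  exact h

lemma eigenvectorUnitary_conjTranspose_mul (hρ : ρ.IsHermitian) :
    (hρ.eigenvectorUnitary : Matrix k k ℂ)ᴴ * (hρ.eigenvectorUnitary : Matrix k k ℂ) = 1 :=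
  Unitary.coe_star_mul_self hρ.eigenvectorUnitary

lemma eigenvectorUnitary_mul_conjTranspose (hρ : ρ.IsHermitian) :
    (hρ.eigenvectorUnitary : Matrix k k ℂ) * (hρ.eigenvectorUnitary : Matrix k k ℂ)ᴴ = 1 :=
  Unitary.coe_mul_star_self hρ.eigenvectorUnitary

lemma overlap_conjTranspose_mul_self (hρ : ρ.IsHermitian) (hR : R.IsHermitian) :
    (overlap hρ hR)ᴴ * overlap hρ hR = 1 := by
  simp only [overlap, conjTranspose_mul, conjTranspose_conjTranspose]
  rw [Matrix.mul_assoc, ← Matrix.mul_assoc _ _ (hρ.eigenvectorUnitary : Matrix k k ℂ),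
    eigenvectorUnitary_mul_conjTranspose, Matrix.one_mul, eigenvectorUnitary_conjTranspose_mul]

lemma sum_normSq_overlap (hρ : ρ.IsHermitian) (hR : R.IsHermitian) (b : k) :
    ∑ a, Complex.normSq (overlap hρ hR a b) = 1 := by
  have h := congrFun (congrFun (overlap_conjTranspose_mul_self hρ hR) b) b
  rw [mul_apply, one_apply_eq] at h
  have h' := congrArg Complex.re h
  simpa [Complex.normSq_apply] using h'

lemma conj_diag_eq_sum_overlap (hρ : ρ.IsHermitian) (hR : R.IsHermitian) (a : k) :
    (((hR.eigenvectorUnitary : Matrix k k ℂ)ᴴ * ρ * (hR.eigenvectorUnitary : Matrix k k ℂ)) a a).re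
      = ∑ b, Complex.normSq (overlap hρ hR a b) * hρ.eigenvalues b := by
  have h : (hR.eigenvectorUnitary : Matrix k k ℂ)ᴴ * ρ * (hR.eigenvectorUnitary : Matrix k k ℂ)
      = overlap hρ hR * diagonal (fun b => (hρ.eigenvalues b : ℂ)) * (overlap hρ hR)ᴴ := by
    conv_lhs => rw [hρ.eq_conj_diagonal]
    simp only [overlap, conjTranspose_mul, conjTranspose_conjTranspose, Matrix.mul_assoc]
  rw [h, mul_apply, Complex.re_sum]
  refine Finset.sum_congr rfl fun b _ => ?_
  simp only [mul_diagonal, conjTranspose_apply, Complex.star_def, Complex.normSq_apply,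
    Complex.mul_re, Complex.mul_im, Complex.ofReal_re, Complex.ofReal_im, Complex.conj_re,
    Complex.conj_im]
  ring

lemma conj_diag_self (hR : R.IsHermitian) (a : k) :
    (((hR.eigenvectorUnitary : Matrix k k ℂ)ᴴ * R * (hR.eigenvectorUnitary : Matrix k k ℂ)) a a).re
      = hR.eigenvalues a := by
  have h : (hR.eigenvectorUnitary : Matrix k k ℂ)ᴴ * R * (hR.eigenvectorUnitary : Matrix k k ℂ)
      = diagonal (fun b => (hR.eigenvalues b : ℂ)) := by
    rw [congrArg ((hR.eigenvectorUnitary : Matrix k k ℂ)ᴴ * ·) hR.eq_conj_diagonal]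
    simp only [Matrix.mul_assoc, eigenvectorUnitary_conjTranspose_mul, Matrix.mul_one]
    rw [← Matrix.mul_assoc, eigenvectorUnitary_conjTranspose_mul, Matrix.one_mul]
  rw [h, diagonal_apply_eq, Complex.ofReal_re]

lemma overlap_mul_eigenvalue_eq_zero_or_pos (hρ : ρ.PosSemidef) (hR : R.PosSemidef) {c : ℝ}
    (hc : 0 < c) (hle : (R - (c : ℂ) • ρ).PosSemidef) (a b : k) :
    Complex.normSq (overlap hρ.isHermitian hR.isHermitian a b) * hρ.isHermitian.eigenvalues b = 0 ∨
      0 < hR.isHermitian.eigenvalues a := by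
  have hterm : ∀ b, 0 ≤ Complex.normSq (overlap hρ.isHermitian hR.isHermitian a b) *
      hρ.isHermitian.eigenvalues b :=
    fun b => mul_nonneg (Complex.normSq_nonneg _) (hρ.eigenvalues_nonneg b)
  have h := (Complex.nonneg_iff.1 ((hle.conjTranspose_mul_mul_same
    (hR.isHermitian.eigenvectorUnitary : Matrix k k ℂ)).diag_nonneg (i := a))).1
  rw [Matrix.mul_sub, Matrix.sub_mul, Matrix.mul_smul, Matrix.smul_mul, Matrix.sub_apply,
    Matrix.smul_apply, smul_eq_mul, Complex.sub_re, Complex.re_ofReal_mul, conj_diag_self,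
    conj_diag_eq_sum_overlap hρ.isHermitian] at h
  have hb := Finset.single_le_sum (fun b _ => hterm b) (Finset.mem_univ b)
  rcases (hterm b).eq_or_lt with h0 | h0
  · exact Or.inl h0.symm
  · right
    nlinarith [mul_pos hc (h0.trans_le hb)]

lemma sum_overlap_mul_eigenvalues (hρ : ρ.IsHermitian) (hR : R.IsHermitian) :
    ∑ a, ∑ b, Complex.normSq (overlap hρ hR a b) * hρ.eigenvalues b = ρ.trace.re := by
  rw [Finset.sum_comm]
  simp_rw [← Finset.sum_mul, sum_normSq_overlap, one_mul]
  rw [hρ.trace_eq_sum_eigenvalues, Complex.re_sum]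
  simp

/-- In the eigenbases, `modularQuadratic` decouples into scalar quadratics. -/
lemma modularQuadratic_conj (hρ : ρ.IsHermitian) (hR : R.IsHermitian) (t : ℝ) (Y : Matrix k k ℂ) :
    modularQuadratic ρ R t ((hR.eigenvectorUnitary : Matrix k k ℂ) * Y *
      (hρ.eigenvectorUnitary : Matrix k k ℂ)ᴴ) =
    ∑ a, ∑ b, (2 * hρ.eigenvalues b * (star (overlap hρ hR a b) * Y a b).re -
      (hR.eigenvalues a + t * hρ.eigenvalues b) * Complex.normSq (Y a b)) := by
  set U := (hR.eigenvectorUnitary : Matrix k k ℂ) with hU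
  set V := (hρ.eigenvectorUnitary : Matrix k k ℂ) with hV
  have hUU : Uᴴ * U = 1 := eigenvectorUnitary_conjTranspose_mul hR
  have hVV : Vᴴ * V = 1 := eigenvectorUnitary_conjTranspose_mul hρ
  have hρe : ρ = V * diagonal (fun b => (hρ.eigenvalues b : ℂ)) * Vᴴ := hρ.eq_conj_diagonal
  have hRe : R = U * diagonal (fun b => (hR.eigenvalues b : ℂ)) * Uᴴ := hR.eq_conj_diagonal
  have cU : ∀ Z : Matrix k k ℂ, Uᴴ * (U * Z) = Z := fun Z => by
    rw [← Matrix.mul_assoc, hUU, Matrix.one_mul]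
  have cV : ∀ Z : Matrix k k ℂ, Vᴴ * (V * Z) = Z := fun Z => by
    rw [← Matrix.mul_assoc, hVV, Matrix.one_mul]
  have e1 : (ρ * (U * Y * Vᴴ)).trace =
      (diagonal (fun b => (hρ.eigenvalues b : ℂ)) * ((overlap hρ hR)ᴴ * Y)).trace := by
    rw [show ρ * (U * Y * Vᴴ) = V * (diagonal (fun b => (hρ.eigenvalues b : ℂ)) *
      ((overlap hρ hR)ᴴ * Y) * Vᴴ) by
        conv_lhs => rw [hρe]
        simp only [overlap, conjTranspose_mul, conjTranspose_conjTranspose, Matrix.mul_assoc,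
          ← hU, ← hV], trace_mul_comm, Matrix.mul_assoc, hVV, Matrix.mul_one]
  have e2 : ((U * Y * Vᴴ)ᴴ * R * (U * Y * Vᴴ)).trace =
      (Yᴴ * (diagonal (fun b => (hR.eigenvalues b : ℂ)) * Y)).trace := by
    rw [show (U * Y * Vᴴ)ᴴ * R * (U * Y * Vᴴ) =
      V * (Yᴴ * (diagonal (fun b => (hR.eigenvalues b : ℂ)) * Y) * Vᴴ) by
        conv_lhs => rw [hRe]
        simp only [conjTranspose_mul, conjTranspose_conjTranspose, Matrix.mul_assoc, cU],
      trace_mul_comm, Matrix.mul_assoc, hVV, Matrix.mul_one]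
  have e3 : ((U * Y * Vᴴ) * ρ * (U * Y * Vᴴ)ᴴ).trace =
      (Y * (diagonal (fun b => (hρ.eigenvalues b : ℂ)) * Yᴴ)).trace := by
    rw [show (U * Y * Vᴴ) * ρ * (U * Y * Vᴴ)ᴴ =
      U * (Y * (diagonal (fun b => (hρ.eigenvalues b : ℂ)) * Yᴴ) * Uᴴ) by
        conv_lhs => rw [hρe]
        simp only [conjTranspose_mul, conjTranspose_conjTranspose, Matrix.mul_assoc, cV],
      trace_mul_comm, Matrix.mul_assoc, hUU, Matrix.mul_one]
  have f1 : (diagonal (fun b => (hρ.eigenvalues b : ℂ)) * ((overlap hρ hR)ᴴ * Y)).trace.re =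
      ∑ a, ∑ b, hρ.eigenvalues b * (star (overlap hρ hR a b) * Y a b).re := by
    rw [Finset.sum_comm]
    simp only [trace, diag_apply, diagonal_mul]
    simp only [mul_apply, conjTranspose_apply, Complex.re_sum, Complex.re_ofReal_mul,
      Finset.mul_sum]
  have f2 : (Yᴴ * (diagonal (fun b => (hR.eigenvalues b : ℂ)) * Y)).trace.re =
      ∑ a, ∑ b, hR.eigenvalues a * Complex.normSq (Y a b) := by
    rw [Finset.sum_comm]
    simp only [trace, diag_apply, mul_apply (M := Yᴴ), diagonal_mul, conjTranspose_apply,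
      Complex.re_sum]
    refine Finset.sum_congr rfl fun b _ => Finset.sum_congr rfl fun a _ => ?_
    simp [Complex.normSq_apply]
    ring
  have f3 : (Y * (diagonal (fun b => (hρ.eigenvalues b : ℂ)) * Yᴴ)).trace.re =
      ∑ a, ∑ b, hρ.eigenvalues b * Complex.normSq (Y a b) := by
    simp only [trace, diag_apply, mul_apply (M := Y), diagonal_mul, conjTranspose_apply,
      Complex.re_sum]
    refine Finset.sum_congr rfl fun b _ => Finset.sum_congr rfl fun a _ => ?_
    simp [Complex.normSq_apply]
    ring
  rw [modularQuadratic, e1, e2, e3, f1, f2, f3]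
  simp only [Finset.mul_sum, ← Finset.sum_sub_distrib]
  refine Finset.sum_congr rfl fun a _ => Finset.sum_congr rfl fun b _ => ?_
  ring

lemma modularQuadratic_le_resolventForm (hρ : ρ.PosSemidef) (hR : R.PosSemidef)
    (hsupp : ∀ a b, Complex.normSq (overlap hρ.isHermitian hR.isHermitian a b) *
      hρ.isHermitian.eigenvalues b = 0 ∨ 0 < hR.isHermitian.eigenvalues a)
    {t : ℝ} (ht : 0 ≤ t) (X : Matrix k k ℂ) :
    modularQuadratic ρ R t X ≤ resolventForm hρ.isHermitian hR.isHermitian t := by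
  have hX : X = (hR.isHermitian.eigenvectorUnitary : Matrix k k ℂ) *
      ((hR.isHermitian.eigenvectorUnitary : Matrix k k ℂ)ᴴ * X *
        (hρ.isHermitian.eigenvectorUnitary : Matrix k k ℂ)) *
      (hρ.isHermitian.eigenvectorUnitary : Matrix k k ℂ)ᴴ := by
    rw [← Matrix.mul_assoc, ← Matrix.mul_assoc, eigenvectorUnitary_mul_conjTranspose,
      Matrix.one_mul, Matrix.mul_assoc, eigenvectorUnitary_mul_conjTranspose, Matrix.mul_one]
  rw [hX, modularQuadratic_conj, resolventForm]
  refine Finset.sum_le_sum fun a _ => Finset.sum_le_sum fun b _ => ?_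
  generalize ((hR.isHermitian.eigenvectorUnitary : Matrix k k ℂ)ᴴ * X *
        (hρ.isHermitian.eigenvectorUnitary : Matrix k k ℂ)) a b = y
  have hs := hρ.eigenvalues_nonneg b
  have hr := hR.eigenvalues_nonneg a
  have h := hsupp a b
  revert hs hr h
  generalize overlap hρ.isHermitian hR.isHermitian a b = u
  generalize hρ.isHermitian.eigenvalues b = s
  generalize hR.isHermitian.eigenvalues a = r
  intro hs hr h
  by_cases hz : Complex.normSq u * s = 0
  · have h1 : s * (star u * y).re = 0 := by
      rcases mul_eq_zero.1 hz with hu | hs0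
      · rw [Complex.normSq_eq_zero.1 hu]; simp
      · rw [hs0, zero_mul]
    have h2 : Complex.normSq u * s ^ 2 = 0 := by rw [pow_two, ← mul_assoc, hz, zero_mul]
    rw [h2, zero_div, mul_assoc, h1]
    have : 0 ≤ (r + t * s) * Complex.normSq y :=
      mul_nonneg (by positivity) (Complex.normSq_nonneg y)
    linarith
  · have hd : 0 < r + t * s := add_pos_of_pos_of_nonneg (h.resolve_left hz) (by positivity)
    rw [le_div_iff₀ hd]
    simp only [Complex.normSq_apply, Complex.star_def, Complex.mul_re, Complex.conj_re,
      Complex.conj_im]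
    nlinarith [sq_nonneg (s * u.re - (r + t * s) * y.re),
      sq_nonneg (s * u.im - (r + t * s) * y.im)]

lemma exists_modularQuadratic_eq_resolventForm (hρ : ρ.IsHermitian) (hR : R.IsHermitian) (t : ℝ) :
    ∃ X, modularQuadratic ρ R t X = resolventForm hρ hR t := by
  refine ⟨_, (modularQuadratic_conj hρ hR t (Matrix.of fun a b =>
    ((hρ.eigenvalues b / (hR.eigenvalues a + t * hρ.eigenvalues b) : ℝ) : ℂ) *
      overlap hρ hR a b)).trans ?_⟩
  rw [resolventForm]
  refine Finset.sum_congr rfl fun a _ => Finset.sum_congr rfl fun b _ => ?_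
  simp only [Matrix.of_apply, Complex.normSq_mul, Complex.normSq_ofReal, Complex.star_def]
  rw [show (starRingEnd ℂ) (overlap hρ hR a b) *
    (((hρ.eigenvalues b / (hR.eigenvalues a + t * hρ.eigenvalues b) : ℝ) : ℂ) * overlap hρ hR a b)
    = ((hρ.eigenvalues b / (hR.eigenvalues a + t * hρ.eigenvalues b) *
      Complex.normSq (overlap hρ hR a b) : ℝ) : ℂ) by
        rw [Complex.ofReal_mul, Complex.normSq_eq_conj_mul_self]; ring, Complex.ofReal_re]
  by_cases hd : hR.eigenvalues a + t * hρ.eigenvalues b = 0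
  · simp [hd]
  · field_simp
    ring

end RelativeEntropy

/-- Monotonicity of the relative entropy under the adjoint of a map `Φ` that intertwines
`modularQuadratic`. -/
lemma relEntropy_le_relEntropy {k l : Type*} [Fintype k] [DecidableEq k] [Fintype l] [DecidableEq l]
    {ρ R : Matrix k k ℂ} {ρ' R' : Matrix l l ℂ}
    (hρ : IsDensityMatrix ρ) (hR : R.PosSemidef) (hρ' : IsDensityMatrix ρ') (hR' : R'.PosSemidef)
    {c : ℝ} (hc : 0 < c) (hle : (R - (c : ℂ) • ρ).PosSemidef)
    (hle' : (R' - (c : ℂ) • ρ').PosSemidef) (Φ : Matrix k k ℂ → Matrix l l ℂ)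
    (hΦ : ∀ t X, modularQuadratic ρ' R' t (Φ X) = modularQuadratic ρ R t X) :
    relEntropy hρ.1.isHermitian hR.isHermitian ≤ relEntropy hρ'.1.isHermitian hR'.isHermitian := by
  have hsupp := overlap_mul_eigenvalue_eq_zero_or_pos hρ.1 hR hc hle
  have hsupp' := overlap_mul_eigenvalue_eq_zero_or_pos hρ'.1 hR' hc hle'
  have hlim := tendsto_integral_resolvent_sum hρ.1.eigenvalues_nonneg hsupp
    (by rw [sum_overlap_mul_eigenvalues, hρ.2, Complex.one_re])
  have hlim' := tendsto_integral_resolvent_sum hρ'.1.eigenvalues_nonneg hsupp'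
    (by rw [sum_overlap_mul_eigenvalues, hρ'.2, Complex.one_re])
  refine le_of_tendsto_of_tendsto hlim.2 hlim'.2 ?_
  filter_upwards [eventually_ge_atTop 0] with T hT
  refine sub_le_sub_right (intervalIntegral.integral_mono_on hT (hlim.1 T hT) (hlim'.1 T hT)
    fun t ht => ?_) _
  obtain ⟨X, hX⟩ := exists_modularQuadratic_eq_resolventForm hρ.1.isHermitian hR.isHermitian t
  change resolventForm hρ.1.isHermitian hR.isHermitian t ≤
    resolventForm hρ'.1.isHermitian hR'.isHermitian t
  rw [← hX, ← hΦ]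
  exact modularQuadratic_le_resolventForm hρ'.1 hR' hsupp' ht.1 _

/-! ### Ensembles -/

lemma posSemidef_sum_smul {J k : Type*} [Fintype k] {q : J → ℝ} (hq : ∀ j, 0 ≤ q j)
    {ρ : J → Matrix k k ℂ} (hρ : ∀ j, (ρ j).PosSemidef) (s : Finset J) :
    (∑ j ∈ s, (q j : ℂ) • ρ j).PosSemidef :=
  posSemidef_sum s fun j _ => (hρ j).smul (Complex.zero_le_real.2 (hq j))

section Ensemble

variable {J : Type*} [Fintype J] {q : J → ℝ}

lemma posSemidef_sum_smul_sub {k : Type*} [Fintype k] (hq : ∀ j, 0 ≤ q j)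
    {ρ : J → Matrix k k ℂ} (hρ : ∀ j, (ρ j).PosSemidef) (j : J) :
    ((∑ j, (q j : ℂ) • ρ j) - (q j : ℂ) • ρ j).PosSemidef := by
  classical
  rw [← Finset.add_sum_erase _ _ (Finset.mem_univ j), add_sub_cancel_left]
  exact posSemidef_sum_smul hq hρ _

lemma vNEntropy_eq {k : Type*} [Fintype k] [DecidableEq k] {ρ : Matrix k k ℂ}
    (hρ : ρ.IsHermitian) :
    vNEntropy ρ = -(∑ a, hρ.eigenvalues a * Real.log (hρ.eigenvalues a)) / Real.log 2 := by
  rw [vNEntropy, dif_pos hρ, neg_div, Finset.sum_div]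
  simp only [Real.logb, mul_div_assoc]

/-- The Holevo information is the mean relative entropy to the average state. -/
lemma holevo_eq_sum_relEntropy {k : Type*} [Fintype k] [DecidableEq k] {ρ : J → Matrix k k ℂ}
    (hρ : ∀ j, (ρ j).IsHermitian) (hR : (∑ j, (q j : ℂ) • ρ j).IsHermitian) :
    holevo q ρ = (∑ j, q j * relEntropy (hρ j) hR) / Real.log 2 := by
  have hD : ∀ j, relEntropy (hρ j) hR =
      ∑ b, (hρ j).eigenvalues b * Real.log ((hρ j).eigenvalues b) -
      ∑ a, (((hR.eigenvectorUnitary : Matrix k k ℂ)ᴴ * ρ j *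
        (hR.eigenvectorUnitary : Matrix k k ℂ)) a a).re * Real.log (hR.eigenvalues a) := by
    intro j
    simp_rw [relEntropy, mul_sub, Finset.sum_sub_distrib, conj_diag_eq_sum_overlap (hρ j),
      Finset.sum_mul]
    congr 1
    rw [Finset.sum_comm]
    refine Finset.sum_congr rfl fun b _ => ?_
    simp_rw [mul_assoc, ← Finset.sum_mul, sum_normSq_overlap, one_mul]
  have hdiag : ∀ a, ∑ j, q j * (((hR.eigenvectorUnitary : Matrix k k ℂ)ᴴ * ρ j *
      (hR.eigenvectorUnitary : Matrix k k ℂ)) a a).re = hR.eigenvalues a := by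
    intro a
    rw [← conj_diag_self hR a, Matrix.mul_sum, Matrix.sum_mul, Matrix.sum_apply, Complex.re_sum]
    refine Finset.sum_congr rfl fun j _ => ?_
    rw [Matrix.mul_smul, Matrix.smul_mul, Matrix.smul_apply, smul_eq_mul, Complex.re_ofReal_mul]
  have hsum : ∑ j, q j * ∑ a, (((hR.eigenvectorUnitary : Matrix k k ℂ)ᴴ * ρ j *
      (hR.eigenvectorUnitary : Matrix k k ℂ)) a a).re * Real.log (hR.eigenvalues a) =
      ∑ a, hR.eigenvalues a * Real.log (hR.eigenvalues a) := by
    simp_rw [Finset.mul_sum]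
    rw [Finset.sum_comm]
    refine Finset.sum_congr rfl fun a _ => ?_
    simp_rw [← mul_assoc, ← Finset.sum_mul, hdiag]
  simp_rw [holevo, vNEntropy_eq hR, vNEntropy_eq (hρ _), hD, mul_sub, Finset.sum_sub_distrib, hsum,
    ← mul_div_assoc, ← Finset.sum_div, mul_neg, Finset.sum_neg_distrib]
  ring

lemma modularQuadratic_kronecker_one {k l : Type*} [Fintype k] [DecidableEq k] [Fintype l]
    [DecidableEq l] {σ : J → Matrix k k ℂ} {η : J → Matrix l l ℂ} (hη : ∀ j, (η j).trace = 1)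
    (j : J) (t : ℝ) (X : Matrix k k ℂ) :
    modularQuadratic (σ j ⊗ₖ η j) (∑ j, (q j : ℂ) • (σ j ⊗ₖ η j)) t (X ⊗ₖ (1 : Matrix l l ℂ)) =
      modularQuadratic (σ j) (∑ j, (q j : ℂ) • σ j) t X := by
  simp only [modularQuadratic, conjTranspose_kronecker, conjTranspose_one, Matrix.mul_sum,
    Matrix.sum_mul, Matrix.mul_smul, Matrix.smul_mul, ← mul_kronecker_mul,
    Matrix.one_mul, trace_sum, trace_smul, trace_kronecker, hη, mul_one]

/-- Discarding a conditionally independent factor does not increase the Holevo information. -/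
lemma holevo_le_holevo_kronecker {k l : Type*} [Fintype k] [DecidableEq k] [Fintype l]
    [DecidableEq l] (hq : ∀ j, 0 ≤ q j) {σ : J → Matrix k k ℂ} {η : J → Matrix l l ℂ}
    (hσ : ∀ j, IsDensityMatrix (σ j)) (hη : ∀ j, IsDensityMatrix (η j)) :
    holevo q σ ≤ holevo q fun j => σ j ⊗ₖ η j := by
  have hστ : ∀ j, IsDensityMatrix (σ j ⊗ₖ η j) := fun j =>
    ⟨(hσ j).1.kronecker (hη j).1, by rw [trace_kronecker, (hσ j).2, (hη j).2, one_mul]⟩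
  have hR := posSemidef_sum_smul hq (fun j => (hσ j).1) Finset.univ
  have hR' := posSemidef_sum_smul hq (fun j => (hστ j).1) Finset.univ
  rw [holevo_eq_sum_relEntropy (fun j => (hσ j).1.isHermitian) hR.isHermitian,
    holevo_eq_sum_relEntropy (fun j => (hστ j).1.isHermitian) hR'.isHermitian]
  refine div_le_div_of_nonneg_right (Finset.sum_le_sum fun j _ => ?_)
    (Real.log_nonneg one_le_two)
  rcases (hq j).eq_or_lt with h0 | h0
  · rw [← h0, zero_mul, zero_mul]
  · exact mul_le_mul_of_nonneg_left (relEntropy_le_relEntropy (hσ j) hR (hστ j) hR' h0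
      (posSemidef_sum_smul_sub hq (fun j => (hσ j).1) j)
      (posSemidef_sum_smul_sub hq (fun j => (hστ j).1) j) _
      (modularQuadratic_kronecker_one (fun j => (hη j).2) j)) (hq j)

end Ensemble

/-- `Δχ^S ≤ Δχ^P` (proof of Theorem 4.2 of the paper): a separable input ensemble is
no better than a product input ensemble. -/
theorem stmt6 {I J : Type} [Fintype I] [Nonempty I] [Fintype J] [Nonempty J] (m n : ℕ)
    (p : I → ℝ) (hp : ∀ i, 0 ≤ p i) (hp1 : ∑ i, p i = 1)
    (q : I → J → ℝ) (hq : ∀ i j, 0 ≤ q i j) (hq1 : ∀ i, ∑ j, q i j = 1)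
    (σ : I → J → Matrix (Fin m) (Fin m) ℂ) (hσ : ∀ i j, IsDensityMatrix (σ i j))
    (η : I → J → Matrix (Fin n) (Fin n) ℂ) (hη : ∀ i j, IsDensityMatrix (η i j)) :
    vNEntropy (∑ i, ∑ j, ((p i * q i j : ℝ) : ℂ) • (σ i j ⊗ₖ η i j))
      - ∑ i, p i * vNEntropy (∑ j, ((q i j : ℝ) : ℂ) • (σ i j ⊗ₖ η i j))
      - vNEntropy (∑ i, ∑ j, ((p i * q i j : ℝ) : ℂ) • σ i j)
      + ∑ i, p i * vNEntropy (∑ j, ((q i j : ℝ) : ℂ) • σ i j)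
      ≤ vNEntropy (∑ i, ∑ j, ((p i * q i j : ℝ) : ℂ) • (σ i j ⊗ₖ η i j))
      - ∑ i, ∑ j, p i * q i j * vNEntropy (σ i j ⊗ₖ η i j)
      - vNEntropy (∑ i, ∑ j, ((p i * q i j : ℝ) : ℂ) • σ i j)
      + ∑ i, ∑ j, p i * q i j * vNEntropy (σ i j) := by
  have h := Finset.sum_le_sum fun i (_ : i ∈ Finset.univ) =>
    mul_le_mul_of_nonneg_left (holevo_le_holevo_kronecker (hq i) (hσ i) (hη i)) (hp i)
  simp only [holevo, mul_sub, Finset.sum_sub_distrib, Finset.mul_sum] at h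
  simp only [mul_assoc]
  linarith
end

section
/- Let I and J be finite nonempty index sets, let (p_i)_{i∈I} be a probability distribution, let (q_{ij})_{j∈J} be a probability distribution for each i ∈ I, and let σ_{ij} be density matrices on ℂ^m and η_{ij} be density matrices on ℂ^n for each (i,j). Then S(∑_{ij} p_i q_{ij} σ_{ij} ⊗ η_{ij}) − ∑_i p_i S(∑_j q_{ij} σ_{ij} ⊗ η_{ij}) − S(∑_{ij} p_i q_{ij} σ_{ij}) + ∑_i p_i S(∑_j q_{ij} σ_{ij}) ≤ S(∑_{ij} p_i q_{ij} η_{ij}) − ∑_{ij} p_i q_{ij} S(η_{ij}). -/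
open scoped Kronecker BigOperators ComplexOrder

open Filter Topology in
theorem tendsto_mul_log_add_mul_sub_log {l m : ℝ} (hl : 0 ≤ l) (c : ℝ) :
    Tendsto (fun t : ℝ => c * l * Real.log (m + t * l) - c * l * Real.log t) atTop
      (𝓝 (c * l * Real.log l)) := by
  rcases hl.eq_or_lt with rfl | hl
  · simp
  have h1 : Tendsto (fun t : ℝ => m / t + l) atTop (𝓝 l) := by
    simpa using (tendsto_const_nhds (x := m)).div_atTop tendsto_id |>.add_const l
  have h2 := ((Real.continuousAt_log hl.ne').tendsto.comp h1).const_mul (c * l)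
  refine h2.congr' ?_
  have h3 : ∀ᶠ t : ℝ in atTop, m / t + l ≠ 0 := h1.eventually_ne hl.ne'
  filter_upwards [eventually_gt_atTop 0, h3] with t ht h0
  have : m + t * l = t * (m / t + l) := by field_simp
  rw [Function.comp_apply, this, Real.log_mul ht.ne' h0]
  ring

open Filter Topology in
theorem tendsto_mul_log_add_mul {a l m : ℝ} (h : m = 0 → a = 0) :
    Tendsto (fun t : ℝ => a * Real.log (m + t * l)) (𝓝[>] 0) (𝓝 (a * Real.log m)) := by
  by_cases hm : m = 0
  · simp [h hm]
  have : ContinuousAt (fun t : ℝ => a * Real.log (m + t * l)) 0 := by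
    refine ContinuousAt.mul continuousAt_const (ContinuousAt.log (by fun_prop) (by simpa))
  simpa using this.tendsto.mono_left nhdsWithin_le_nhds

theorem hasDerivAt_mul_log_add_mul {c l m t : ℝ} (hl : 0 ≤ l) (hm : 0 ≤ m) (ht : 0 < t) :
    HasDerivAt (fun t : ℝ => c * l * Real.log (m + t * l)) (c * (l ^ 2 / (m + t * l))) t := by
  rcases hl.eq_or_lt with rfl | hl
  · simpa using hasDerivAt_const t (0 : ℝ)
  have h : HasDerivAt (fun t : ℝ => m + t * l) l t := by
    simpa using ((hasDerivAt_id t).mul_const l).const_add m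
  exact ((h.log (by positivity)).const_mul (c * l)).congr_deriv (by ring)

open Filter Topology in
/-- Integrated over `t`, a comparison of the quasi-entropies `∑ c l² / (m + t l)` yields the
comparison of the relative entropies `∑ c l (log l - log m)`. -/
theorem sum_mul_log_sub_le_of_sum_sq_div_le {α β : Type*} [Fintype α] [Fintype β]
    {c l m : α → ℝ} {c' l' m' : β → ℝ}
    (hl : ∀ a, 0 ≤ l a) (hm : ∀ a, 0 ≤ m a) (hl' : ∀ b, 0 ≤ l' b) (hm' : ∀ b, 0 ≤ m' b)
    (hs : ∀ a, m a = 0 → c a * l a = 0) (hs' : ∀ b, m' b = 0 → c' b * l' b = 0)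
    (htr : ∑ a, c a * l a = ∑ b, c' b * l' b)
    (hQ : ∀ t : ℝ, 0 < t → ∑ b, c' b * (l' b ^ 2 / (m' b + t * l' b))
      ≤ ∑ a, c a * (l a ^ 2 / (m a + t * l a))) :
    ∑ a, c a * l a * Real.log (m a) - ∑ b, c' b * l' b * Real.log (m' b)
      ≤ ∑ a, c a * l a * Real.log (l a) - ∑ b, c' b * l' b * Real.log (l' b) := by
  set F : ℝ → ℝ := fun t => ∑ a, c a * l a * Real.log (m a + t * l a)
    - ∑ b, c' b * l' b * Real.log (m' b + t * l' b) with hF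
  have hder : ∀ t : ℝ, 0 < t → HasDerivAt F (∑ a, c a * (l a ^ 2 / (m a + t * l a))
      - ∑ b, c' b * (l' b ^ 2 / (m' b + t * l' b))) t := fun t ht =>
    (HasDerivAt.fun_sum fun a _ => hasDerivAt_mul_log_add_mul (hl a) (hm a) ht).sub
      (HasDerivAt.fun_sum fun b _ => hasDerivAt_mul_log_add_mul (hl' b) (hm' b) ht)
  have hmono : MonotoneOn F (Set.Ioi 0) := by
    refine monotoneOn_of_deriv_nonneg (convex_Ioi 0)
      (fun t ht => (hder t ht).continuousAt.continuousWithinAt)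
      (fun t ht => ?_) (fun t ht => ?_)
    · rw [interior_Ioi] at ht
      exact (hder t ht).differentiableAt.differentiableWithinAt
    · rw [interior_Ioi] at ht
      rw [(hder t ht).deriv]
      exact sub_nonneg.2 (hQ t ht)
  have h0 : Tendsto F (𝓝[>] 0) (𝓝 (∑ a, c a * l a * Real.log (m a)
      - ∑ b, c' b * l' b * Real.log (m' b))) :=
    (tendsto_finsetSum _ fun a _ => tendsto_mul_log_add_mul (hs a)).sub
      (tendsto_finsetSum _ fun b _ => tendsto_mul_log_add_mul (hs' b))
  have hinf : Tendsto F atTop (𝓝 (∑ a, c a * l a * Real.log (l a)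
      - ∑ b, c' b * l' b * Real.log (l' b))) := by
    refine ((tendsto_finsetSum Finset.univ fun a _ =>
      tendsto_mul_log_add_mul_sub_log (m := m a) (hl a) (c a)).sub
      (tendsto_finsetSum Finset.univ fun b _ =>
        tendsto_mul_log_add_mul_sub_log (m := m' b) (hl' b) (c' b))).congr fun t => ?_
    simp only [hF, Finset.sum_sub_distrib, ← Finset.sum_mul, htr]
    ring
  refine le_of_tendsto h0 ?_
  filter_upwards [self_mem_nhdsWithin] with s hs
  refine ge_of_tendsto hinf ?_
  filter_upwards [eventually_ge_atTop s] with t ht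
  exact hmono hs (lt_of_lt_of_le hs ht) ht
/-- `U` is unitary and `ρ = U diag(d) Uᴴ`. -/
def Matrix.IsDiagonalizedBy {n : Type*} [Fintype n] [DecidableEq n] (ρ U : Matrix n n ℂ)
    (d : n → ℝ) : Prop :=
  (U.conjTranspose * U = 1 ∧ U * U.conjTranspose = 1) ∧
    ρ = U * Matrix.diagonal (fun i => (d i : ℂ)) * U.conjTranspose

/-- The diagonal of `ρ` in the orthonormal basis formed by the columns of `V`. -/
noncomputable def Matrix.diagIn {n : Type*} [Fintype n] (V ρ : Matrix n n ℂ) (l : n) : ℝ :=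
  ((V.conjTranspose * ρ * V) l l).re

namespace Matrix

variable {n n' : Type*} [Fintype n] [Fintype n']

theorem diagIn_sum_smul {α : Type*} [Fintype α] (V : Matrix n n ℂ) (w : α → ℝ)
    (ρ : α → Matrix n n ℂ) (l : n) :
    diagIn V (∑ a, ((w a : ℝ) : ℂ) • ρ a) l = ∑ a, w a * diagIn V (ρ a) l := by
  simp [diagIn, Matrix.mul_sum, Matrix.sum_mul, Matrix.sum_apply]

theorem PosSemidef.diagIn_nonneg {ρ : Matrix n n ℂ} (h : ρ.PosSemidef) (V : Matrix n n ℂ) (l : n) :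
    0 ≤ diagIn V ρ l :=
  (Complex.le_def.1 (h.conjTranspose_mul_mul_same V).diag_nonneg).1

theorem PosSemidef.diagIn_kronecker {ρ : Matrix n n ℂ} {ρ' : Matrix n' n' ℂ} (h : ρ.PosSemidef)
    (V : Matrix n n ℂ) (V' : Matrix n' n' ℂ) (x : n × n') :
    diagIn (V ⊗ₖ V') (ρ ⊗ₖ ρ') x = diagIn V ρ x.1 * diagIn V' ρ' x.2 := by
  have him : ((V.conjTranspose * ρ * V) x.1 x.1).im = 0 :=
    (Complex.le_def.1 (h.conjTranspose_mul_mul_same V).diag_nonneg).2.symm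
  simp [diagIn, conjTranspose_kronecker, ← mul_kronecker_mul, Complex.mul_re, him]

/-- The quadratic functional whose supremum over `X` is the quasi-entropy of `ρ` and `σ`. -/
noncomputable def quasiEntropyForm (t : ℝ) (ρ σ X : Matrix n n ℂ) : ℝ :=
  2 * (ρ * X).trace.re - (σ * (X.conjTranspose * X)).trace.re
    - t * (ρ * (X * X.conjTranspose)).trace.re

theorem quasiEntropyForm_kronecker_one [DecidableEq n'] {R S : Matrix (n × n') (n × n') ℂ} {ρ σ : Matrix n n ℂ}
    (hR : ∀ X : Matrix n n ℂ, (R * (X ⊗ₖ (1 : Matrix n' n' ℂ))).trace = (ρ * X).trace)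
    (hS : ∀ X : Matrix n n ℂ, (S * (X ⊗ₖ (1 : Matrix n' n' ℂ))).trace = (σ * X).trace)
    (t : ℝ) (X : Matrix n n ℂ) :
    quasiEntropyForm t R S (X ⊗ₖ 1) = quasiEntropyForm t ρ σ X := by
  simp only [quasiEntropyForm, conjTranspose_kronecker, ← mul_kronecker_mul, conjTranspose_one,
    Matrix.mul_one, hR, hS]

theorem sum_smul_kronecker_mul_trace [DecidableEq n'] {α : Type*} [Fintype α] (w : α → ℝ)
    (σ : α → Matrix n n ℂ) (η : α → Matrix n' n' ℂ) (hη : ∀ a, (η a).trace = 1)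
    (X : Matrix n n ℂ) :
    ((∑ a, ((w a : ℝ) : ℂ) • (σ a ⊗ₖ η a)) * (X ⊗ₖ (1 : Matrix n' n' ℂ))).trace =
      ((∑ a, ((w a : ℝ) : ℂ) • σ a) * X).trace := by
  simp only [Matrix.sum_mul, trace_sum, smul_mul, trace_smul, ← mul_kronecker_mul,
    trace_kronecker, hη, mul_one]

variable [DecidableEq n] [DecidableEq n']

theorem IsHermitian.isDiagonalizedBy {ρ : Matrix n n ℂ} (h : ρ.IsHermitian) :
    ρ.IsDiagonalizedBy (h.eigenvectorUnitary : Matrix n n ℂ) h.eigenvalues := by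
  refine ⟨⟨?_, ?_⟩, ?_⟩
  · exact Unitary.coe_star_mul_self _
  · exact Unitary.coe_mul_star_self _
  · exact h.spectral_theorem

theorem IsDiagonalizedBy.kronecker {ρ U : Matrix n n ℂ} {d : n → ℝ} {ρ' U' : Matrix n' n' ℂ}
    {d' : n' → ℝ} (h : ρ.IsDiagonalizedBy U d) (h' : ρ'.IsDiagonalizedBy U' d') :
    (ρ ⊗ₖ ρ').IsDiagonalizedBy (U ⊗ₖ U') (fun x => d x.1 * d' x.2) := by
  refine ⟨⟨?_, ?_⟩, ?_⟩
  · rw [conjTranspose_kronecker, ← mul_kronecker_mul, h.1.1, h'.1.1, one_kronecker_one]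
  · rw [conjTranspose_kronecker, ← mul_kronecker_mul, h.1.2, h'.1.2, one_kronecker_one]
  · rw [h.2, h'.2, mul_kronecker_mul, mul_kronecker_mul, diagonal_kronecker_diagonal,
      conjTranspose_kronecker]
    simp

theorem IsDiagonalizedBy.diagIn_self {ρ U : Matrix n n ℂ} {d : n → ℝ}
    (h : ρ.IsDiagonalizedBy U d) : diagIn U ρ = d := by
  have : U.conjTranspose * ρ * U = diagonal (fun i => (d i : ℂ)) := by
    rw [h.2]
    simp only [Matrix.mul_assoc, h.1.1]
    rw [← Matrix.mul_assoc, h.1.1]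
    simp
  funext l
  simp [diagIn, this]

theorem sum_diagIn {V : Matrix n n ℂ} (hV : V * V.conjTranspose = 1) (ρ : Matrix n n ℂ) :
    ∑ l, diagIn V ρ l = ρ.trace.re := by
  have : (V.conjTranspose * ρ * V).trace = ρ.trace := by
    rw [trace_mul_comm, ← Matrix.mul_assoc, hV, Matrix.one_mul]
  rw [← this, trace, Complex.re_sum]
  rfl

theorem IsDiagonalizedBy.diagIn_eq {ρ U : Matrix n n ℂ} {d : n → ℝ}
    (h : ρ.IsDiagonalizedBy U d) (V : Matrix n n ℂ) (l : n) :
    diagIn V ρ l = ∑ k, Complex.normSq ((U.conjTranspose * V) k l) * d k := by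
  have : V.conjTranspose * ρ * V = (U.conjTranspose * V).conjTranspose *
      diagonal (fun i => (d i : ℂ)) * (U.conjTranspose * V) := by
    rw [h.2]
    simp [Matrix.mul_assoc]
  rw [diagIn, this, mul_apply, Complex.re_sum]
  refine Finset.sum_congr rfl fun k _ => ?_
  rw [mul_diagonal, conjTranspose_apply, Complex.normSq_apply]
  simp [Complex.mul_re]
  ring

theorem sum_normSq_of_mul_conjTranspose_eq_one {W : Matrix n n ℂ} (hW : W * W.conjTranspose = 1)
    (k : n) : ∑ l, Complex.normSq (W k l) = 1 := by
  have := congrFun (congrFun hW k) k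
  rw [mul_apply] at this
  simp only [conjTranspose_apply, one_apply_eq, Complex.star_def, Complex.mul_conj] at this
  exact_mod_cast this

theorem quasiEntropyForm_eq {ρ σ U V : Matrix n n ℂ} {d e : n → ℝ} (hρ : ρ.IsDiagonalizedBy U d)
    (hσ : σ.IsDiagonalizedBy V e) (t : ℝ) (Y : Matrix n n ℂ) :
    quasiEntropyForm t ρ σ (U * Y * V.conjTranspose) =
      ∑ x : n × n, (2 * d x.1 * (Y x.1 x.2 * star ((U.conjTranspose * V) x.1 x.2)).re
        - (e x.2 + t * d x.1) * Complex.normSq (Y x.1 x.2)) := by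
  have h1 : (ρ * (U * Y * V.conjTranspose)).trace =
      (diagonal (fun i => (d i : ℂ)) * (Y * (U.conjTranspose * V).conjTranspose)).trace := by
    rw [hρ.2]
    have : U * diagonal (fun i => (d i : ℂ)) * U.conjTranspose * (U * Y * V.conjTranspose) =
        U * (diagonal (fun i => (d i : ℂ)) * (U.conjTranspose * U) * Y * V.conjTranspose) := by
      simp only [Matrix.mul_assoc]
    rw [this, hρ.1.1, trace_mul_comm]
    simp [Matrix.mul_assoc]
  have h2 : (σ * ((U * Y * V.conjTranspose).conjTranspose * (U * Y * V.conjTranspose))).trace =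
      (diagonal (fun i => (e i : ℂ)) * (Y.conjTranspose * Y)).trace := by
    rw [hσ.2]
    have : V * diagonal (fun i => (e i : ℂ)) * V.conjTranspose *
        ((U * Y * V.conjTranspose).conjTranspose * (U * Y * V.conjTranspose)) =
        V * (diagonal (fun i => (e i : ℂ)) * (V.conjTranspose * V) * Y.conjTranspose *
          (U.conjTranspose * U) * Y * V.conjTranspose) := by
      simp [Matrix.mul_assoc]
    rw [this, hρ.1.1, hσ.1.1, trace_mul_comm]
    simp [Matrix.mul_assoc, hσ.1.1]
  have h3 : (ρ * ((U * Y * V.conjTranspose) * (U * Y * V.conjTranspose).conjTranspose)).trace =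
      (diagonal (fun i => (d i : ℂ)) * (Y * Y.conjTranspose)).trace := by
    rw [hρ.2]
    have : U * diagonal (fun i => (d i : ℂ)) * U.conjTranspose *
        ((U * Y * V.conjTranspose) * (U * Y * V.conjTranspose).conjTranspose) =
        U * (diagonal (fun i => (d i : ℂ)) * (U.conjTranspose * U) * Y *
          (V.conjTranspose * V) * Y.conjTranspose * U.conjTranspose) := by
      simp [Matrix.mul_assoc]
    rw [this, hρ.1.1, hσ.1.1, trace_mul_comm]
    simp [Matrix.mul_assoc, hρ.1.1]
  have e1 : (diagonal (fun i => (d i : ℂ)) *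
      (Y * (U.conjTranspose * V).conjTranspose)).trace.re =
      ∑ k, ∑ l, d k * (Y k l * star ((U.conjTranspose * V) k l)).re := by
    simp only [trace, diag_apply, diagonal_mul, Complex.re_sum, Complex.re_ofReal_mul]
    simp only [mul_apply (M := Y), conjTranspose_apply, Complex.re_sum, Finset.mul_sum]
  have e2 : (diagonal (fun i => (e i : ℂ)) * (Y.conjTranspose * Y)).trace.re =
      ∑ k, ∑ l, e l * Complex.normSq (Y k l) := by
    rw [Finset.sum_comm]
    simp only [trace, diag_apply, diagonal_mul, Complex.re_sum, Complex.re_ofReal_mul]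
    simp only [mul_apply, conjTranspose_apply, Complex.re_sum, Finset.mul_sum, Complex.star_def,
      ← Complex.normSq_eq_conj_mul_self, Complex.ofReal_re]
  have e3 : (diagonal (fun i => (d i : ℂ)) * (Y * Y.conjTranspose)).trace.re =
      ∑ k, ∑ l, d k * Complex.normSq (Y k l) := by
    simp only [trace, diag_apply, diagonal_mul, Complex.re_sum, Complex.re_ofReal_mul]
    simp only [mul_apply, conjTranspose_apply, Complex.re_sum, Finset.mul_sum, Complex.star_def,
      Complex.mul_conj, Complex.ofReal_re]
  rw [quasiEntropyForm, h1, h2, h3, e1, e2, e3, Fintype.sum_prod_type]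
  simp only [Finset.mul_sum, ← Finset.sum_sub_distrib]
  refine Finset.sum_congr rfl fun k _ => Finset.sum_congr rfl fun l _ => ?_
  ring

theorem two_mul_re_sub_le {d s : ℝ} (hs : 0 ≤ s) (h : s = 0 → d = 0) (y w : ℂ) :
    2 * d * (y * star w).re - s * Complex.normSq y ≤ Complex.normSq w * (d ^ 2 / s) := by
  rcases hs.eq_or_lt with rfl | hs
  · simp [h rfl]
  have h1 : Complex.normSq w * (d ^ 2 / s) - (2 * d * (y * star w).re - s * Complex.normSq y)
      = ((s * y.re - d * w.re) ^ 2 + (s * y.im - d * w.im) ^ 2) / s := by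
    simp only [Complex.normSq_apply, Complex.star_def, Complex.mul_re, Complex.conj_re,
      Complex.conj_im]
    field_simp
    ring
  have h2 : 0 ≤ ((s * y.re - d * w.re) ^ 2 + (s * y.im - d * w.im) ^ 2) / s := by positivity
  linarith

theorem two_mul_re_sub_eq {d s : ℝ} (h : s = 0 → d = 0) (w : ℂ) :
    2 * d * (((d / s : ℝ) : ℂ) * w * star w).re - s * Complex.normSq (((d / s : ℝ) : ℂ) * w)
      = Complex.normSq w * (d ^ 2 / s) := by
  by_cases hs : s = 0
  · simp [h hs, hs]
  rw [mul_assoc (((d / s : ℝ) : ℂ)), Complex.star_def, Complex.mul_conj, ← Complex.ofReal_mul,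
    Complex.ofReal_re, Complex.normSq_mul, Complex.normSq_ofReal]
  field_simp
  ring

theorem eq_zero_of_add_mul_eq_zero {d e t : ℝ} (hd : 0 ≤ d) (he : 0 ≤ e) (ht : 0 < t)
    (h : e + t * d = 0) : d = 0 := by
  by_contra hne
  have : 0 < t * d := mul_pos ht (lt_of_le_of_ne hd (Ne.symm hne))
  linarith

theorem quasiEntropyForm_le {ρ σ U V : Matrix n n ℂ} {d e : n → ℝ} (hρ : ρ.IsDiagonalizedBy U d)
    (hσ : σ.IsDiagonalizedBy V e) (hd : ∀ k, 0 ≤ d k) (he : ∀ l, 0 ≤ e l) {t : ℝ} (ht : 0 < t)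
    (X : Matrix n n ℂ) :
    quasiEntropyForm t ρ σ X ≤ ∑ x : n × n, Complex.normSq ((U.conjTranspose * V) x.1 x.2) *
      (d x.1 ^ 2 / (e x.2 + t * d x.1)) := by
  have hX : X = U * (U.conjTranspose * X * V) * V.conjTranspose := by
    have : U * (U.conjTranspose * X * V) * V.conjTranspose =
        (U * U.conjTranspose) * X * (V * V.conjTranspose) := by
      simp only [Matrix.mul_assoc]
    rw [this, hρ.1.2, hσ.1.2, Matrix.one_mul, Matrix.mul_one]
  rw [hX, quasiEntropyForm_eq hρ hσ]
  refine Finset.sum_le_sum fun x _ => two_mul_re_sub_le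
    (add_nonneg (he _) (mul_nonneg ht.le (hd _)))
    (eq_zero_of_add_mul_eq_zero (hd _) (he _) ht) _ _

theorem exists_quasiEntropyForm_eq {ρ σ U V : Matrix n n ℂ} {d e : n → ℝ}
    (hρ : ρ.IsDiagonalizedBy U d) (hσ : σ.IsDiagonalizedBy V e)
    (hd : ∀ k, 0 ≤ d k) (he : ∀ l, 0 ≤ e l) {t : ℝ} (ht : 0 < t) :
    ∃ X, quasiEntropyForm t ρ σ X =
      ∑ x : n × n, Complex.normSq ((U.conjTranspose * V) x.1 x.2) *
        (d x.1 ^ 2 / (e x.2 + t * d x.1)) := by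
  refine ⟨U * (Matrix.of fun k l => ((d k / (e l + t * d k) : ℝ) : ℂ) *
    (U.conjTranspose * V) k l) * V.conjTranspose, ?_⟩
  rw [quasiEntropyForm_eq hρ hσ]
  exact Finset.sum_congr rfl fun x _ =>
    two_mul_re_sub_eq (eq_zero_of_add_mul_eq_zero (hd _) (he _) ht) _

theorem sum_normSq_mul_fst {U V : Matrix n n ℂ} (hU : U.conjTranspose * U = 1)
    (hV : V * V.conjTranspose = 1) (f : n → ℝ) :
    ∑ x : n × n, Complex.normSq ((U.conjTranspose * V) x.1 x.2) * f x.1 = ∑ k, f k := by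
  have hW : (U.conjTranspose * V) * (U.conjTranspose * V).conjTranspose = 1 := by
    have : (U.conjTranspose * V) * (U.conjTranspose * V).conjTranspose =
      U.conjTranspose * (V * V.conjTranspose) * U := by simp [Matrix.mul_assoc]
    rw [this, hV, Matrix.mul_one, hU]
  rw [Fintype.sum_prod_type]
  simp only [← Finset.sum_mul, sum_normSq_of_mul_conjTranspose_eq_one hW, one_mul]

theorem IsDiagonalizedBy.sum_diagIn_mul {ρ U : Matrix n n ℂ} {d : n → ℝ}
    (h : ρ.IsDiagonalizedBy U d) (V : Matrix n n ℂ) (f : n → ℝ) :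
    ∑ x : n × n, Complex.normSq ((U.conjTranspose * V) x.1 x.2) * d x.1 * f x.2 =
      ∑ l, diagIn V ρ l * f l := by
  rw [Fintype.sum_prod_type, Finset.sum_comm]
  simp only [← Finset.sum_mul, ← h.diagIn_eq V]

theorem IsDiagonalizedBy.normSq_mul_eq_zero {ρ U : Matrix n n ℂ} {d : n → ℝ}
    (h : ρ.IsDiagonalizedBy U d) (hd : ∀ k, 0 ≤ d k) {V : Matrix n n ℂ} {l : n}
    (hl : diagIn V ρ l = 0) (k : n) :
    Complex.normSq ((U.conjTranspose * V) k l) * d k = 0 := by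
  rw [h.diagIn_eq, Finset.sum_eq_zero_iff_of_nonneg
    fun _ _ => mul_nonneg (Complex.normSq_nonneg _) (hd _)] at hl
  exact hl k (Finset.mem_univ k)

/-- **Monotonicity of relative entropy** under the partial trace, for states given by their
spectral decompositions. The matrices `ρ`, `σ` are the marginals of `R`, `S`. -/
theorem relativeEntropy_mono_partialTrace
    {R S U V : Matrix (n × n') (n × n') ℂ} {ρ σ u v : Matrix n n ℂ}
    {D E : n × n' → ℝ} {d e : n → ℝ}
    (hR : R.IsDiagonalizedBy U D) (hS : S.IsDiagonalizedBy V E)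
    (hρ : ρ.IsDiagonalizedBy u d) (hσ : σ.IsDiagonalizedBy v e)
    (hD : ∀ k, 0 ≤ D k) (hE : ∀ k, 0 ≤ E k) (hd : ∀ k, 0 ≤ d k) (he : ∀ k, 0 ≤ e k)
    (hsupp : ∀ l, E l = 0 → diagIn V R l = 0) (hsupp' : ∀ l, e l = 0 → diagIn v ρ l = 0)
    (hRρ : ∀ X : Matrix n n ℂ, (R * (X ⊗ₖ (1 : Matrix n' n' ℂ))).trace = (ρ * X).trace)
    (hSσ : ∀ X : Matrix n n ℂ, (S * (X ⊗ₖ (1 : Matrix n' n' ℂ))).trace = (σ * X).trace) :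
    ∑ l, diagIn V R l * Real.log (E l) - ∑ l, diagIn v ρ l * Real.log (e l) ≤
      ∑ k, D k * Real.log (D k) - ∑ k, d k * Real.log (d k) := by
  have htr : R.trace = ρ.trace := by simpa using hRρ 1
  have := sum_mul_log_sub_le_of_sum_sq_div_le
    (c := fun x : (n × n') × (n × n') => Complex.normSq ((U.conjTranspose * V) x.1 x.2))
    (l := fun x => D x.1) (m := fun x => E x.2)
    (c' := fun x : n × n => Complex.normSq ((u.conjTranspose * v) x.1 x.2))
    (l' := fun x => d x.1) (m' := fun x => e x.2)
    (fun _ => hD _) (fun _ => hE _) (fun _ => hd _) (fun _ => he _)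
    (fun x hx => hR.normSq_mul_eq_zero hD (hsupp _ hx) _)
    (fun x hx => hρ.normSq_mul_eq_zero hd (hsupp' _ hx) _)
    (by
      have h1 := hR.sum_diagIn_mul V (fun _ => 1)
      have h2 := hρ.sum_diagIn_mul v (fun _ => 1)
      simp only [mul_one] at h1 h2
      rw [h1, h2, sum_diagIn hS.1.2, sum_diagIn hσ.1.2, htr])
    (fun t ht => by
      obtain ⟨X, hX⟩ := exists_quasiEntropyForm_eq hρ hσ hd he ht
      rw [← hX, ← quasiEntropyForm_kronecker_one hRρ hSσ]
      exact quasiEntropyForm_le hR hS hD hE ht _)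
  rw [hR.sum_diagIn_mul V fun l => Real.log (E l), hρ.sum_diagIn_mul v fun l => Real.log (e l)]
    at this
  simp only [mul_assoc] at this
  rwa [sum_normSq_mul_fst hR.1.1 hS.1.2 fun k => D k * Real.log (D k),
    sum_normSq_mul_fst hρ.1.1 hσ.1.2 fun k => d k * Real.log (d k)] at this

end Matrix

theorem Matrix.PosSemidef.sum_ofReal_smul {n α : Type*} [Fintype n] [Fintype α] {w : α → ℝ}
    (hw : ∀ a, 0 ≤ w a) {ρ : α → Matrix n n ℂ} (hρ : ∀ a, (ρ a).PosSemidef) :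
    (∑ a, ((w a : ℝ) : ℂ) • ρ a).PosSemidef :=
  Matrix.posSemidef_sum _ fun a _ => (hρ a).smul (by exact_mod_cast hw a)

section Entropy

open Matrix

variable {n n' α : Type*} [Fintype n] [Fintype n'] [Fintype α]

theorem mul_mul_log_mul (x y : ℝ) :
    x * y * Real.log (x * y) = y * (x * Real.log x) + x * (y * Real.log y) := by
  by_cases hx : x = 0
  · simp [hx]
  by_cases hy : y = 0
  · simp [hy]
  rw [Real.log_mul hx hy]
  ring

theorem sum_mul_mul_log_mul {d : n → ℝ} {d' : n' → ℝ} (hd : ∑ k, d k = 1) (hd' : ∑ k, d' k = 1) :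
    ∑ x : n × n', d x.1 * d' x.2 * Real.log (d x.1 * d' x.2) =
      ∑ k, d k * Real.log (d k) + ∑ k, d' k * Real.log (d' k) := by
  simp only [mul_mul_log_mul, Fintype.sum_prod_type, Finset.sum_add_distrib, ← Finset.mul_sum,
    ← Finset.sum_mul, hd, hd', one_mul]

theorem diagIn_eq_zero_of_sum_eq_zero {w : α → ℝ} (hw : ∀ a, 0 ≤ w a) {ρ : α → Matrix n n ℂ}
    (hρ : ∀ a, (ρ a).PosSemidef) {V : Matrix n n ℂ} {l : n}
    (h : diagIn V (∑ a, ((w a : ℝ) : ℂ) • ρ a) l = 0) (a : α) :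
    w a * diagIn V (ρ a) l = 0 := by
  rw [diagIn_sum_smul, Finset.sum_eq_zero_iff_of_nonneg
    fun a _ => mul_nonneg (hw a) ((hρ a).diagIn_nonneg V l)] at h
  exact h a (Finset.mem_univ a)

theorem sum_mul_sum_diagIn_mul (w : α → ℝ) (ρ : α → Matrix n n ℂ) (V : Matrix n n ℂ)
    (f : n → ℝ) :
    ∑ a, w a * ∑ l, diagIn V (ρ a) l * f l =
      ∑ l, diagIn V (∑ a, ((w a : ℝ) : ℂ) • ρ a) l * f l := by
  simp only [diagIn_sum_smul, Finset.mul_sum, Finset.sum_mul]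
  rw [Finset.sum_comm]
  simp only [mul_assoc]

variable [DecidableEq n] [DecidableEq n']

theorem vNEntropy_mul_log_two {ρ : Matrix n n ℂ} (h : ρ.IsHermitian) :
    vNEntropy ρ * Real.log 2 = -∑ k, h.eigenvalues k * Real.log (h.eigenvalues k) := by
  have : Real.log 2 ≠ 0 := (Real.log_pos one_lt_two).ne'
  rw [vNEntropy, dif_pos h, neg_mul, Finset.sum_mul]
  congr 1
  refine Finset.sum_congr rfl fun k _ => ?_
  rw [Real.logb]
  field_simp

theorem IsDensityMatrix.sum_diagIn {ρ : Matrix n n ℂ} (h : IsDensityMatrix ρ) {V : Matrix n n ℂ}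
    (hV : V * V.conjTranspose = 1) : ∑ l, diagIn V ρ l = 1 := by
  rw [Matrix.sum_diagIn hV, h.2, Complex.one_re]

theorem IsDensityMatrix.sum_eigenvalues {ρ : Matrix n n ℂ} (h : IsDensityMatrix ρ) :
    ∑ k, h.1.1.eigenvalues k = 1 := by
  rw [← h.1.1.isDiagonalizedBy.diagIn_self]
  exact h.sum_diagIn h.1.1.isDiagonalizedBy.1.2

/-- For separable states, the conditional entropy `S(B|A)` is at least the average entropy of the
`B`-components. -/
theorem sum_vNEntropy_le_condEntropy {w : α → ℝ} (hw : ∀ a, 0 ≤ w a)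
    {σ : α → Matrix n n ℂ} (hσ : ∀ a, IsDensityMatrix (σ a))
    {η : α → Matrix n' n' ℂ} (hη : ∀ a, IsDensityMatrix (η a)) :
    ∑ a, w a * vNEntropy (η a) ≤
      vNEntropy (∑ a, ((w a : ℝ) : ℂ) • (σ a ⊗ₖ η a)) - vNEntropy (∑ a, ((w a : ℝ) : ℂ) • σ a) := by
  have hprod : ∀ a, (σ a ⊗ₖ η a).PosSemidef := fun a => (hσ a).1.kronecker (hη a).1
  have hR := PosSemidef.sum_ofReal_smul hw hprod
  have hr := PosSemidef.sum_ofReal_smul hw fun a => (hσ a).1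
  have hRd := hR.1.isDiagonalizedBy
  have hrd := hr.1.isDiagonalizedBy
  have key : ∀ a, w a * (∑ l, diagIn hR.1.eigenvectorUnitary (σ a ⊗ₖ η a) l *
        Real.log (hR.1.eigenvalues l)) -
      w a * (∑ l, diagIn hr.1.eigenvectorUnitary (σ a) l * Real.log (hr.1.eigenvalues l)) ≤
      w a * ∑ k, (hη a).1.1.eigenvalues k * Real.log ((hη a).1.1.eigenvalues k) := by
    intro a
    by_cases h0 : w a = 0
    · simp [h0]
    have := relativeEntropy_mono_partialTrace
      ((hσ a).1.1.isDiagonalizedBy.kronecker (hη a).1.1.isDiagonalizedBy) hRd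
      (hσ a).1.1.isDiagonalizedBy hrd
      (fun x => mul_nonneg ((hσ a).1.eigenvalues_nonneg _) ((hη a).1.eigenvalues_nonneg _))
      hR.eigenvalues_nonneg (hσ a).1.eigenvalues_nonneg hr.eigenvalues_nonneg
      (fun l hl => (mul_eq_zero.1 (diagIn_eq_zero_of_sum_eq_zero hw hprod
        (by rw [hRd.diagIn_self, hl]) a)).resolve_left h0)
      (fun l hl => (mul_eq_zero.1 (diagIn_eq_zero_of_sum_eq_zero hw (fun a => (hσ a).1)
        (by rw [hrd.diagIn_self, hl]) a)).resolve_left h0)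
      (fun X => by rw [← mul_kronecker_mul, trace_kronecker, Matrix.mul_one, (hη a).2, mul_one])
      (sum_smul_kronecker_mul_trace w σ η fun a => (hη a).2)
    rw [sum_mul_mul_log_mul (hσ a).sum_eigenvalues (hη a).sum_eigenvalues,
      add_sub_cancel_left] at this
    rw [← mul_sub]
    exact mul_le_mul_of_nonneg_left this (hw a)
  have hsum := Finset.sum_le_sum fun a (_ : a ∈ Finset.univ) => key a
  rw [Finset.sum_sub_distrib, sum_mul_sum_diagIn_mul, sum_mul_sum_diagIn_mul, hRd.diagIn_self,
    hrd.diagIn_self] at hsum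
  refine le_of_mul_le_mul_right ?_ (Real.log_pos one_lt_two)
  rw [sub_mul, vNEntropy_mul_log_two hR.1, vNEntropy_mul_log_two hr.1, Finset.sum_mul]
  simp only [mul_assoc, fun a => vNEntropy_mul_log_two (hη a).1.1, mul_neg,
    Finset.sum_neg_distrib]
  linarith

theorem IsDensityMatrix.sum_smul {w : α → ℝ} (hw : ∀ a, 0 ≤ w a) (hw1 : ∑ a, w a = 1)
    {σ : α → Matrix n n ℂ} (hσ : ∀ a, IsDensityMatrix (σ a)) :
    IsDensityMatrix (∑ a, ((w a : ℝ) : ℂ) • σ a) := by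
  refine ⟨PosSemidef.sum_ofReal_smul hw fun a => (hσ a).1, ?_⟩
  simp only [trace_sum, trace_smul, fun a => (hσ a).2, smul_eq_mul, mul_one]
  exact_mod_cast hw1

/-- Subadditivity of the von Neumann entropy on separable states. -/
theorem vNEntropy_sum_kronecker_le {w : α → ℝ} (hw : ∀ a, 0 ≤ w a) (hw1 : ∑ a, w a = 1)
    {σ : α → Matrix n n ℂ} (hσ : ∀ a, IsDensityMatrix (σ a))
    {η : α → Matrix n' n' ℂ} (hη : ∀ a, IsDensityMatrix (η a)) :
    vNEntropy (∑ a, ((w a : ℝ) : ℂ) • (σ a ⊗ₖ η a)) ≤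
      vNEntropy (∑ a, ((w a : ℝ) : ℂ) • σ a) + vNEntropy (∑ a, ((w a : ℝ) : ℂ) • η a) := by
  have hR := PosSemidef.sum_ofReal_smul hw fun a => (hσ a).1.kronecker (hη a).1
  have hr := IsDensityMatrix.sum_smul hw hw1 hσ
  have hs := IsDensityMatrix.sum_smul hw hw1 hη
  have hrd := hr.1.1.isDiagonalizedBy
  have hsd := hs.1.1.isDiagonalizedBy
  set u : Matrix n n ℂ := (hr.1.1.eigenvectorUnitary : Matrix n n ℂ)
  set v : Matrix n' n' ℂ := (hs.1.1.eigenvectorUnitary : Matrix n' n' ℂ)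
  set d := hr.1.1.eigenvalues
  set e := hs.1.1.eigenvalues
  set P : n × n' → ℝ := diagIn (u ⊗ₖ v) (∑ a, ((w a : ℝ) : ℂ) • (σ a ⊗ₖ η a)) with hP
  have hPeq : ∀ x, P x = ∑ a, w a * (diagIn u (σ a) x.1 * diagIn v (η a) x.2) := fun x => by
    rw [hP, diagIn_sum_smul]
    simp only [fun a => (hσ a).1.diagIn_kronecker u v x]
  have hP1 : ∀ x : n × n', d x.1 = 0 → P x = 0 := fun x hx => by
    rw [hPeq]
    refine Finset.sum_eq_zero fun a _ => ?_
    rw [← mul_assoc, diagIn_eq_zero_of_sum_eq_zero hw (fun a => (hσ a).1)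
      (by rw [hrd.diagIn_self, hx]) a, zero_mul]
  have hP2 : ∀ x : n × n', e x.2 = 0 → P x = 0 := fun x hx => by
    rw [hPeq]
    refine Finset.sum_eq_zero fun a _ => ?_
    rw [mul_left_comm, diagIn_eq_zero_of_sum_eq_zero hw (fun a => (hη a).1)
      (by rw [hsd.diagIn_self, hx]) a, mul_zero]
  have hm1 : ∀ k, ∑ l, P (k, l) = d k := fun k => by
    simp only [hPeq]
    rw [Finset.sum_comm]
    simp only [← Finset.mul_sum, fun a => (hη a).sum_diagIn hsd.1.2, mul_one]
    rw [← diagIn_sum_smul, hrd.diagIn_self]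
  have hm2 : ∀ l, ∑ k, P (k, l) = e l := fun l => by
    simp only [hPeq]
    rw [Finset.sum_comm]
    simp only [← Finset.mul_sum, ← Finset.sum_mul, fun a => (hσ a).sum_diagIn hrd.1.2, one_mul]
    rw [← diagIn_sum_smul, hsd.diagIn_self]
  have hlog : ∑ x, P x * Real.log (d x.1 * e x.2) =
      ∑ k, d k * Real.log (d k) + ∑ l, e l * Real.log (e l) := by
    have : ∀ x, P x * Real.log (d x.1 * e x.2) =
        P x * Real.log (d x.1) + P x * Real.log (e x.2) := fun x => by
      by_cases h1 : d x.1 = 0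
      · simp [hP1 x h1]
      by_cases h2 : e x.2 = 0
      · simp [hP2 x h2]
      rw [Real.log_mul h1 h2, mul_add]
    simp only [this, Finset.sum_add_distrib]
    congr 1
    · simp only [Fintype.sum_prod_type, ← Finset.sum_mul, hm1]
    · rw [Fintype.sum_prod_type, Finset.sum_comm]
      simp only [← Finset.sum_mul, hm2]
  have := relativeEntropy_mono_partialTrace hR.1.isDiagonalizedBy (hrd.kronecker hsd) hrd hrd
    hR.eigenvalues_nonneg
    (fun x => mul_nonneg (hr.1.eigenvalues_nonneg _) (hs.1.eigenvalues_nonneg _))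
    hr.1.eigenvalues_nonneg hr.1.eigenvalues_nonneg
    (fun x hx => (mul_eq_zero.1 hx).elim (hP1 x) (hP2 x))
    (fun l hl => by rw [hrd.diagIn_self, hl])
    (sum_smul_kronecker_mul_trace w σ η fun a => (hη a).2)
    (fun X => by rw [← mul_kronecker_mul, trace_kronecker, Matrix.mul_one, hs.2, mul_one])
  rw [hlog, hrd.diagIn_self] at this
  refine le_of_mul_le_mul_right ?_ (Real.log_pos one_lt_two)
  rw [add_mul, vNEntropy_mul_log_two hR.1, vNEntropy_mul_log_two hr.1.1,
    vNEntropy_mul_log_two hs.1.1]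
  linarith

end Entropy

/-- `Δχ^S ≤ Δχ^0` (combined chain of inequalities in the proof of Theorem 4.2 of the
paper): the gain in local Holevo information from any separable input ensemble is
bounded by the Holevo information of the channel-output states alone. -/
theorem stmt7 {I J : Type} [Fintype I] [Nonempty I] [Fintype J] [Nonempty J] (m n : ℕ)
    (p : I → ℝ) (hp : ∀ i, 0 ≤ p i) (hp1 : ∑ i, p i = 1)
    (q : I → J → ℝ) (hq : ∀ i j, 0 ≤ q i j) (hq1 : ∀ i, ∑ j, q i j = 1)
    (σ : I → J → Matrix (Fin m) (Fin m) ℂ) (hσ : ∀ i j, IsDensityMatrix (σ i j))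
    (η : I → J → Matrix (Fin n) (Fin n) ℂ) (hη : ∀ i j, IsDensityMatrix (η i j)) :
    vNEntropy (∑ i, ∑ j, ((p i * q i j : ℝ) : ℂ) • (σ i j ⊗ₖ η i j))
      - ∑ i, p i * vNEntropy (∑ j, ((q i j : ℝ) : ℂ) • (σ i j ⊗ₖ η i j))
      - vNEntropy (∑ i, ∑ j, ((p i * q i j : ℝ) : ℂ) • σ i j)
      + ∑ i, p i * vNEntropy (∑ j, ((q i j : ℝ) : ℂ) • σ i j)
      ≤ vNEntropy (∑ i, ∑ j, ((p i * q i j : ℝ) : ℂ) • η i j)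
      - ∑ i, ∑ j, p i * q i j * vNEntropy (η i j) := by
  have hw : ∀ a : I × J, 0 ≤ p a.1 * q a.1 a.2 := fun a => mul_nonneg (hp _) (hq _ _)
  have hw1 : ∑ a : I × J, p a.1 * q a.1 a.2 = 1 := by
    simp only [Fintype.sum_prod_type, ← Finset.mul_sum, hq1, mul_one, hp1]
  have hsub := vNEntropy_sum_kronecker_le hw hw1 (fun a => hσ a.1 a.2) (fun a => hη a.1 a.2)
  simp only [Fintype.sum_prod_type] at hsub
  have hcond := Finset.sum_le_sum fun i (_ : i ∈ Finset.univ) =>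
    mul_le_mul_of_nonneg_left (sum_vNEntropy_le_condEntropy (hq i) (hσ i) (hη i)) (hp i)
  simp only [mul_sub, Finset.sum_sub_distrib, Finset.mul_sum, ← mul_assoc] at hcond
  linarith
end
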